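/- Let T ⊆ ℝ and let (X_t)_{t∈T} be a centered Gaussian process on a probability space (i.e., every finite collection (X_{t_1},…,X_{t_k}) is a centered Gaussian random vector), with covariance function C(s,t) = E[X_s X_t] satisfying C(t,t) > 0 for every t ∈ T. Then the following are equivalent: (i) X is Markov, in the sense that for every finite collection s_1 ≤ s_2 ≤ … ≤ s_n ≤ t ≤ u in T one has E[X_u | σ(X_{s_1},…,X_{s_n},X_t)] = E[X_u | σ(X_t)] almost surely; (ii) C(s,u)·C(t,t) = C(s,t)·C(t,u) for all s ≤ t ≤ u in T. -/

import Mathlib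

open MeasureTheory ProbabilityTheory

/-- A process whose finite linear combinations are all real Gaussian is a Gaussian process. -/
theorem isGaussianProcess_of_forall_sum_map_eq_gaussianReal
    {Ω : Type*} [MeasurableSpace Ω] {P : Measure Ω} {ι : Type*} {X : ι → Ω → ℝ}
    (hX : ∀ i, Measurable (X i))
    (h : ∀ (k : ℕ) (t : Fin k → ι) (a : Fin k → ℝ), ∃ (m : ℝ) (v : NNReal),
      P.map (fun ω => ∑ i, a i * X (t i) ω) = gaussianReal m v) :
    IsGaussianProcess X P where
  hasGaussianLaw I := by
    classical
    refine ⟨isGaussian_of_map_eq_gaussianReal fun L => ?_⟩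
    let e := I.equivFin
    obtain ⟨m, v, hv⟩ := h I.card (fun k => (e.symm k : ι))
      (fun k => L (fun l => if e.symm k = l then 1 else 0))
    refine ⟨m, v, ?_⟩
    rw [Measure.map_map L.measurable (f := fun ω => I.restrict (X · ω))
      (measurable_pi_lambda _ fun i => hX i), ← hv]
    congr 1
    ext ω
    rw [Function.comp_apply, ← ContinuousLinearMap.coe_coe L, LinearMap.pi_apply_eq_sum_univ,
      ← Equiv.sum_comp e.symm]
    simp [mul_comm]

/-- Adding a centered variable independent of `m` to an `m`-measurable variable does not change
its conditional expectation given `m`. -/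
theorem MeasureTheory.condExp_add_of_indep_of_integral_eq_zero
    {Ω : Type*} {m mΩ : MeasurableSpace Ω} {P : Measure Ω} [IsFiniteMeasure P] {Y Z : Ω → ℝ}
    (hm : m ≤ mΩ) (hYm : StronglyMeasurable[m] Y) (hY : Integrable Y P)
    (hZmeas : Measurable Z) (hZ : Integrable Z P) (hZ0 : P[Z] = 0)
    (hind : Indep (MeasurableSpace.comap Z inferInstance) m P) :
    P[Y + Z | m] =ᵐ[P] Y := by
  filter_upwards [condExp_add hY hZ m, condExp_indep_eq hZmeas.comap_le hm
    (comap_measurable Z).stronglyMeasurable hind] with ω h1 h2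
  rw [h1, Pi.add_apply, h2, hZ0, add_zero, condExp_of_stronglyMeasurable hm hYm hY]

/-- The integral against an `m`-measurable variable is unchanged by conditioning on `m`. -/
theorem MeasureTheory.integral_mul_condExp_of_stronglyMeasurable
    {Ω : Type*} {m mΩ : MeasurableSpace Ω} {P : Measure Ω} [IsFiniteMeasure P] {f g : Ω → ℝ}
    (hm : m ≤ mΩ) (hf : StronglyMeasurable[m] f) (hfg : Integrable (f * g) P)
    (hg : Integrable g P) :
    P[f * P[g | m]] = P[f * g] := by
  rw [← integral_condExp hm (f := f * g)]
  exact integral_congr_ae (condExp_mul_of_stronglyMeasurable_left hf hfg hg).symm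

/-- In a centered Gaussian process, if the residual `X u - c X (s j)` is uncorrelated with every
`X (s i)`, then `c X (s j)` is the conditional expectation of `X u` given all the `X (s i)`. -/
theorem ProbabilityTheory.IsGaussianProcess.condExp_iSup_comap_eq_const_mul
    {Ω : Type*} [MeasurableSpace Ω] {P : Measure Ω} {ι κ : Type*} {X : ι → Ω → ℝ}
    (hX : IsGaussianProcess X P) (hmeas : ∀ i, Measurable (X i)) (h0 : ∀ i, P[X i] = 0)
    (s : κ → ι) (j : κ) (u : ι) (c : ℝ)
    (hcov : ∀ i, P[X (s i) * X u] = c * P[X (s i) * X (s j)]) :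
    P[X u | ⨆ i, MeasurableSpace.comap (X (s i)) (borel ℝ)] =ᵐ[P] fun ω => c * X (s j) ω := by
  classical
  have := hX.isProbabilityMeasure
  have hL2 (i : ι) : MemLp (X i) 2 P := (hX.hasGaussianLaw_eval i).memLp_two
  have hint (i : ι) : Integrable (X i) P := (hL2 i).integrable one_le_two
  rw [← BorelSpace.measurable_eq (α := ℝ)]
  set Z : Ω → ℝ := fun ω => X u ω - c * X (s j) ω with hZ
  have hZmeas : Measurable Z := (hmeas u).sub ((hmeas (s j)).const_mul c)
  have hZL2 : MemLp Z 2 P := (hL2 u).sub ((hL2 (s j)).const_mul c)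
  have hZ0 : P[Z] = 0 := by
    rw [hZ, integral_sub (hint u) ((hint (s j)).const_mul c), integral_const_mul, h0, h0]
    simp
  have hjoint : IsGaussianProcess (Sum.elim (fun i => X (s i)) (fun _ : Unit => Z)) P := by
    refine hX.of_isGaussianProcess ?_
    rintro (i | _)
    · exact ⟨{s i}, ContinuousLinearMap.proj ⟨s i, by simp⟩, fun ω => by simp⟩
    · exact ⟨{u, s j}, ContinuousLinearMap.proj ⟨u, by simp⟩ -
        c • ContinuousLinearMap.proj ⟨s j, by simp⟩, fun ω => by simp [hZ]⟩
  have hindep : IndepFun (fun ω i => X (s i) ω) (fun ω (_ : Unit) => Z ω) P := by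
    refine hjoint.indepFun_of_covariance_eq_zero (fun i => (hmeas (s i)).aemeasurable)
      (fun _ => hZmeas.aemeasurable) fun i _ => ?_
    rw [covariance_eq_sub (hL2 (s i)) hZL2, hZ0, mul_zero, sub_zero]
    have hmul : X (s i) * Z = fun ω => (X (s i) * X u) ω - c * (X (s i) * X (s j)) ω := by
      ext ω
      simp only [hZ, Pi.mul_apply]
      ring
    rw [hmul, integral_sub ((hL2 (s i)).integrable_mul (hL2 u))
      (((hL2 (s i)).integrable_mul (hL2 (s j))).const_mul c), integral_const_mul, hcov, sub_self]
  have hZind : Indep (MeasurableSpace.comap Z inferInstance)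
      (⨆ i, MeasurableSpace.comap (X (s i)) inferInstance) P := by
    have hcomap : MeasurableSpace.comap (fun ω i => X (s i) ω) MeasurableSpace.pi =
        ⨆ i, MeasurableSpace.comap (X (s i)) inferInstance := by
      simp [MeasurableSpace.pi, MeasurableSpace.comap_iSup, MeasurableSpace.comap_comp,
        Function.comp_def]
    rw [← hcomap]
    exact (hindep.comp measurable_id (measurable_pi_apply ())).symm
  have hsum : X u = (fun ω => c * X (s j) ω) + Z := by
    ext ω
    simp [hZ]
  rw [hsum]
  refine condExp_add_of_indep_of_integral_eq_zero (iSup_le fun i => (hmeas (s i)).comap_le) ?_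
    ((hint (s j)).const_mul c) hZmeas (hZL2.integrable one_le_two) hZ0 hZind
  exact (((comap_measurable (X (s j))).mono (le_iSup (fun i =>
    MeasurableSpace.comap (X (s i)) inferInstance) j) le_rfl).const_mul c).stronglyMeasurable

/-- A centered Gaussian process `X` indexed by `T ⊆ ℝ` with covariance
function `C` satisfying `C t t > 0` is Markov (conditional expectations given finitely many
past values and the present value coincide a.s. with the conditional expectation given the
present value) if and only if `C s u * C t t = C s t * C t u` for all `s ≤ t ≤ u` in `T`. -/
theorem stmt_0
    {Ω : Type*} [MeasurableSpace Ω] (P : Measure Ω) [IsProbabilityMeasure P]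
    (T : Set ℝ) (X : ℝ → Ω → ℝ) (C : ℝ → ℝ → ℝ)
    (hXmeas : ∀ t ∈ T, Measurable (X t))
    -- every finite collection of values of the process is a centered Gaussian vector:
    -- all linear combinations are centered Gaussian random variables
    (hGauss : ∀ (k : ℕ) (t : Fin k → ℝ), (∀ i, t i ∈ T) →
      ∀ a : Fin k → ℝ, ∃ v : NNReal,
        Measure.map (fun ω => ∑ i, a i * X (t i) ω) P = gaussianReal 0 v)
    -- `C` is the covariance function of the (centered) process
    (hC : ∀ s ∈ T, ∀ t ∈ T, C s t = ∫ ω, X s ω * X t ω ∂P)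
    (hCpos : ∀ t ∈ T, 0 < C t t) :
    (∀ (n : ℕ) (s : Fin n → ℝ) (t u : ℝ),
        (∀ i, s i ∈ T) → t ∈ T → u ∈ T →
        Monotone s → (∀ i, s i ≤ t) → t ≤ u →
        P[X u | (⨆ i, MeasurableSpace.comap (X (s i)) (borel ℝ)) ⊔
            MeasurableSpace.comap (X t) (borel ℝ)]
          =ᵐ[P] P[X u | MeasurableSpace.comap (X t) (borel ℝ)])
      ↔
    (∀ s ∈ T, ∀ t ∈ T, ∀ u ∈ T, s ≤ t → t ≤ u →
        C s u * C t t = C s t * C t u) := by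
  let Y : T → Ω → ℝ := fun t => X t
  have hYmeas (t : T) : Measurable (Y t) := hXmeas t t.2
  have hY : IsGaussianProcess Y P :=
    isGaussianProcess_of_forall_sum_map_eq_gaussianReal hYmeas fun k t a =>
      ⟨0, hGauss k (fun i => t i) (fun i => (t i).2) a⟩
  have h0 (t : T) : P[Y t] = 0 := by
    obtain ⟨v, hv⟩ := hGauss 1 (fun _ => t) (fun _ => t.2) (fun _ => 1)
    simp only [Finset.univ_unique, one_mul, Finset.sum_const, Finset.card_singleton,
      one_smul] at hv
    have h := integral_map (μ := P) (hYmeas t).aemeasurable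
      (f := id) measurable_id.aestronglyMeasurable
    rw [show P.map (Y t) = gaussianReal 0 v from hv] at h
    simpa using h.symm
  have hL2 (t : T) : MemLp (Y t) 2 P := (hY.hasGaussianLaw_eval t).memLp_two
  have hCY (s t : T) : P[Y s * Y t] = C s t := (hC s s.2 t t.2).symm
  -- the conditional expectation given the present is the linear regression on it
  have hreg (n : ℕ) (s : Fin n → T) (t u : T)
      (h : ∀ i, C (s i) u * C t t = C (s i) t * C t u) :
      P[Y u | (⨆ i, MeasurableSpace.comap (Y (s i)) (borel ℝ)) ⊔
        MeasurableSpace.comap (Y t) (borel ℝ)] =ᵐ[P] fun ω => C t u / C t t * Y t ω := by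
    have hpos := (hCpos t t.2).ne'
    have := hY.condExp_iSup_comap_eq_const_mul hYmeas h0 (fun o : Option (Fin n) => o.elim t s)
      none u (C t u / C t t) (by
        rintro (_ | i)
        · simp only [Option.elim_none, hCY]
          field_simp
        · simp only [Option.elim_some, Option.elim_none, hCY]
          field_simp
          linarith [h i])
    simpa only [iSup_option, Option.elim_none, Option.elim_some, sup_comm] using this
  have hpresent (t u : T) : P[Y u | MeasurableSpace.comap (Y t) (borel ℝ)]
      =ᵐ[P] fun ω => C t u / C t t * Y t ω := by
    simpa using hreg 0 Fin.elim0 t u (fun i => i.elim0)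
  constructor
  · intro hM s hs t ht u hu hst htu
    lift s to T using hs
    lift t to T using ht
    lift u to T using hu
    have hcond := (hM 1 (fun _ => s) t u (fun _ => s.2) t.2 u.2 (fun _ _ _ => le_rfl)
      (fun _ => hst) htu).trans (hpresent t u)
    have hCsu : C s u = C t u / C t t * C s t := by
      rw [← hCY s u, ← hCY s t, ← integral_const_mul,
        ← integral_mul_condExp_of_stronglyMeasurable
          (m := (⨆ _ : Fin 1, MeasurableSpace.comap (X s) (borel ℝ)) ⊔
            MeasurableSpace.comap (X t) (borel ℝ)) ?_ ?_
          ((hL2 s).integrable_mul (hL2 u)) ((hL2 u).integrable one_le_two)]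
      · refine integral_congr_ae ?_
        filter_upwards [hcond] with ω h
        simp only [Pi.mul_apply]
        rw [h]
        ring
      · rw [← BorelSpace.measurable_eq (α := ℝ)]
        exact sup_le (iSup_le fun _ => (hYmeas s).comap_le) (hYmeas t).comap_le
      · refine ((comap_measurable (Y s)).mono ?_ le_rfl).stronglyMeasurable
        rw [← BorelSpace.measurable_eq (α := ℝ)]
        exact le_sup_of_le_left (le_iSup_of_le (0 : Fin 1) le_rfl)
    have hpos := (hCpos t t.2).ne'
    rw [hCsu]
    field_simp
  · intro h n s t u hs ht hu _ hst htu
    exact (hreg n (fun i => ⟨s i, hs i⟩) ⟨t, ht⟩ ⟨u, hu⟩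
      (fun i => h (s i) (hs i) t ht u hu (hst i) htu)).trans (hpresent ⟨t, ht⟩ ⟨u, hu⟩).symm
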